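/- arXiv:1901.05838 — 2 statements merged into one kernel-verified Lean document; each statement's English description precedes it below -/
import Mathlib

section
/- Let u : ℝ → ℝ be a nonconstant real analytic 2π-periodic function satisfying F(u(φ), u''(φ)) = 0 for all φ ∈ ℝ, where F : ℝ × ℝ → ℝ is real analytic and uniformly elliptic (there is δ > 0 with ∂F/∂q(u,q) ≥ δ for all (u,q)). Suppose every critical point of u is a local extremum point and the extrema of u are leveled. Let φ_{i−1} < φ_i < φ_{i+1} be three consecutive critical points of u such that φ_i is a local maximum point. Then u(φ) = u(2φ_i − φ) for all φ ∈ [φ_{i−1}, φ_i], and 2φ_i − φ_{i−1} = φ_{i+1}, i.e. φ_i is the midpoint of φ_{i−1} and φ_{i+1}. -/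
/-- Partial derivative of `F : ℝ × ℝ → ℝ` with respect to its second argument `q`. -/
noncomputable def partialQ (F : ℝ × ℝ → ℝ) (p : ℝ × ℝ) : ℝ :=
  deriv (fun q => F (p.1, q)) p.2

open Set Filter Topology

/-- A partial derivative bounded below by `δ` gives the mean value estimate in the second variable. -/
theorem mul_abs_sub_le_of_le_partialQ {F : ℝ × ℝ → ℝ} (hF : Differentiable ℝ F) {δ : ℝ}
    (hell : ∀ p : ℝ × ℝ, δ ≤ partialQ F p) (a p q : ℝ) :
    δ * |p - q| ≤ |F (a, p) - F (a, q)| := by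
  have hd : Differentiable ℝ fun q => F (a, q) :=
    hF.comp ((differentiable_const a).prodMk differentiable_id)
  have key : ∀ x y : ℝ, x ≤ y → δ * (y - x) ≤ F (a, y) - F (a, x) := fun x y hxy =>
    mul_sub_le_image_sub_of_le_deriv hd (fun z => hell (a, z)) hxy
  rcases le_total p q with h | h
  · rw [abs_sub_comm p q, abs_of_nonneg (sub_nonneg.2 h), abs_sub_comm]
    exact (key p q h).trans (le_abs_self _)
  · rw [abs_of_nonneg (sub_nonneg.2 h)]
    exact (key q p h).trans (le_abs_self _)

/-- A function with vanishing Cauchy data at `a` whose second derivative is eventually bounded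
by a multiple of the function vanishes on a right neighbourhood of `a`. -/
theorem eventually_eq_zero_of_abs_deriv2_le {w w' w'' : ℝ → ℝ} {a C : ℝ}
    (hw : ∀ x, HasDerivAt w (w' x) x) (hw' : ∀ x, HasDerivAt w' (w'' x) x)
    (h0 : w a = 0) (h0' : w' a = 0) (hC : ∀ᶠ x in 𝓝 a, |w'' x| ≤ C * |w x|) :
    ∀ᶠ x in 𝓝[>] a, w x = 0 := by
  obtain ⟨ε, hε, hb⟩ := Metric.eventually_nhds_iff.1 hC
  have hd : ∀ x, HasDerivAt (fun x => (w x, w' x)) (w' x, w'' x) x :=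
    fun x => (hw x).prodMk (hw' x)
  have hz : ∀ x ∈ Icc a (a + ε), (w x, w' x) = 0 := by
    refine eq_zero_of_abs_deriv_le_mul_abs_self_of_eq_zero_right (K := max 1 C)
      (fun x _ => (hd x).continuousAt.continuousWithinAt)
      (fun x _ => (hd x).hasDerivWithinAt) (by simp [h0, h0']) fun x hx => ?_
    have hx' : |w'' x| ≤ C * |w x| := by
      apply hb
      rw [Real.dist_eq, abs_of_nonneg (sub_nonneg.2 hx.1)]
      linarith [hx.2]
    have hm : 0 ≤ max 1 C := zero_le_one.trans (le_max_left _ _)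
    simp only [Prod.norm_mk, Real.norm_eq_abs]
    refine max_le ?_ ?_
    · calc |w' x| ≤ max |w x| |w' x| := le_max_right _ _
        _ ≤ _ := le_mul_of_one_le_left (by positivity) (le_max_left _ _)
    · calc |w'' x| ≤ C * |w x| := hx'
        _ ≤ max 1 C * |w x| := by gcongr; exact le_max_right _ _
        _ ≤ _ := by gcongr; exact le_max_left _ _
  filter_upwards [Ioo_mem_nhdsGT (show a < a + ε by linarith)] with x hx
  exact congrArg Prod.fst (hz x (Ioo_subset_Icc_self hx))

/-- Analytic solutions of an elliptic equation `F (u, u'') = 0` are symmetric about each of their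
critical points. -/
theorem eq_reflection_of_deriv_eq_zero {F : ℝ × ℝ → ℝ} (hFanal : ∀ p : ℝ × ℝ, AnalyticAt ℝ F p)
    {δ : ℝ} (hδ : 0 < δ) (hell : ∀ p : ℝ × ℝ, δ ≤ partialQ F p)
    {u : ℝ → ℝ} (huanal : ∀ x : ℝ, AnalyticAt ℝ u x)
    (heq : ∀ x : ℝ, F (u x, deriv (deriv u) x) = 0) {c : ℝ} (hc : deriv u c = 0) (x : ℝ) :
    u x = u (2 * c - x) := by
  have hu : ∀ x, HasDerivAt u (deriv u x) x :=
    fun x => (huanal x).differentiableAt.hasDerivAt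
  have hu' : ∀ x, HasDerivAt (deriv u) (deriv (deriv u) x) x :=
    fun x => (huanal x).deriv.differentiableAt.hasDerivAt
  have hr : ∀ x, HasDerivAt (fun x : ℝ => 2 * c - x) (-1) x :=
    fun x => (hasDerivAt_id x).const_sub (2 * c)
  have hcc : 2 * c - c = c := by ring
  have hrc : Tendsto (fun x : ℝ => 2 * c - x) (𝓝 c) (𝓝 c) := by
    simpa only [hcc] using (hr c).continuousAt.tendsto
  obtain ⟨K, t, ht, hL⟩ :=
    ((hFanal (u c, deriv (deriv u) c)).contDiffAt (n := 1)).exists_lipschitzOnWith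
  have hcont : Tendsto (fun x => u x) (𝓝 c) (𝓝 (u c)) := (hu c).continuousAt
  have hcont' : Tendsto (deriv (deriv u)) (𝓝 c) (𝓝 (deriv (deriv u) c)) :=
    (huanal c).deriv.deriv.continuousAt
  have hbound : ∀ᶠ x in 𝓝 c, |deriv (deriv u) x - deriv (deriv u) (2 * c - x)| ≤
      K / δ * |u x - u (2 * c - x)| := by
    filter_upwards [(hcont.prodMk_nhds (hcont'.comp hrc)).eventually ht,
      ((hcont.comp hrc).prodMk_nhds (hcont'.comp hrc)).eventually ht] with x hx hy
    have h1 := mul_abs_sub_le_of_le_partialQ (fun p => (hFanal p).differentiableAt) hell (u x)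
      (deriv (deriv u) x) (deriv (deriv u) (2 * c - x))
    have h2 := hL.dist_le_mul _ hx _ hy
    simp only [Function.comp_apply, Prod.dist_eq, dist_self, Real.dist_eq, heq,
      abs_nonneg, sup_of_le_left, sub_zero] at h2
    rw [heq, zero_sub, abs_neg] at h1
    rw [div_mul_eq_mul_div, le_div_iff₀ hδ, mul_comm]
    exact h1.trans h2
  have hev := eventually_eq_zero_of_abs_deriv2_le (a := c)
    (w := fun x => u x - u (2 * c - x)) (w' := fun x => deriv u x + deriv u (2 * c - x))
    (w'' := fun x => deriv (deriv u) x - deriv (deriv u) (2 * c - x))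
    (fun x => ((hu x).sub ((hu (2 * c - x)).comp x (hr x))).congr_deriv (by ring))
    (fun x => ((hu' x).add ((hu' (2 * c - x)).comp x (hr x))).congr_deriv (by ring))
    (by simp [hcc]) (by simp [hcc, hc]) hbound
  have hfreq : ∃ᶠ x in 𝓝[≠] c, u x = u (2 * c - x) :=
    (hev.mono fun x hx => sub_eq_zero.1 hx).frequently.filter_mono
      (nhdsWithin_mono c fun x hx => ne_of_gt hx)
  have hv : AnalyticOnNhd ℝ (fun x => u (2 * c - x)) univ := fun x _ =>
    (huanal (2 * c - x)).comp (f := fun x : ℝ => 2 * c - x) (by fun_prop)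
  exact congrFun (AnalyticOnNhd.eq_of_frequently_eq (fun x _ => huanal x) hv hfreq) x


/-- **Equality for reflections, one-dimensional case.**
If `φ_{i−1} < φ_i < φ_{i+1}` are consecutive critical points of a nonconstant
analytic `2π`-periodic solution of `F(u, u'') = 0` (F analytic, uniformly
elliptic), with all critical points local extrema, leveled extrema, and `φ_i`
a local maximum, then `u(φ) = u(2φ_i − φ)` on `[φ_{i−1}, φ_i]`, and `φ_i` is
the midpoint of `φ_{i−1}` and `φ_{i+1}`. -/
theorem equality_for_reflections
    (F : ℝ × ℝ → ℝ) (hFanal : ∀ p : ℝ × ℝ, AnalyticAt ℝ F p)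
    (δ : ℝ) (hδ : 0 < δ) (hell : ∀ p : ℝ × ℝ, δ ≤ partialQ F p)
    (u : ℝ → ℝ) (huanal : ∀ x : ℝ, AnalyticAt ℝ u x)
    (hper : Function.Periodic u (2 * Real.pi))
    (hnonconst : ∃ x y : ℝ, u x ≠ u y)
    (heq : ∀ φ : ℝ, F (u φ, deriv (deriv u) φ) = 0)
    (hextr : ∀ φ : ℝ, deriv u φ = 0 → IsLocalMax u φ ∨ IsLocalMin u φ)
    (hlev : ∃ M m : ℝ, (∀ φ : ℝ, IsLocalMax u φ → u φ = M) ∧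
      (∀ φ : ℝ, IsLocalMin u φ → u φ = m))
    (φim1 φi φip1 : ℝ) (h1 : φim1 < φi) (h2 : φi < φip1)
    (hc1 : deriv u φim1 = 0) (hc2 : deriv u φi = 0) (hc3 : deriv u φip1 = 0)
    (hconsec1 : ∀ φ : ℝ, φim1 < φ → φ < φi → deriv u φ ≠ 0)
    (hconsec2 : ∀ φ : ℝ, φi < φ → φ < φip1 → deriv u φ ≠ 0)
    (hmax : IsLocalMax u φi) :
    (∀ φ ∈ Set.Icc φim1 φi, u φ = u (2 * φi - φ)) ∧
      2 * φi - φim1 = φip1 := by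
  have hsym := eq_reflection_of_deriv_eq_zero hFanal hδ hell huanal heq hc2
  have hderiv : ∀ x, deriv u x = 0 → deriv u (2 * φi - x) = 0 := fun x hx => by
    have h := deriv_comp_const_sub (f := u) (2 * φi) x
    rw [← funext hsym, hx] at h
    linarith
  refine ⟨fun φ _ => hsym φ, ?_⟩
  rcases lt_trichotomy (2 * φi - φim1) φip1 with h | h | h
  · exact absurd (hderiv _ hc1) (hconsec2 _ (by linarith) h)
  · exact h
  · exact absurd (hderiv _ hc3) (hconsec1 _ (by linarith) (by linarith))
end

section
/- Under the hypotheses of the one-dimensional main theorem — u : ℝ → ℝ nonconstant, real analytic, 2π-periodic, solving F(u, u'') = 0 with F real analytic and uniformly elliptic, every critical point of u a local extremum, and the extrema leveled — if u has exactly N critical points φ_1 < ... < φ_N in [0, 2π), then these critical points are equally spaced, φ_{i+1} − φ_i = 2π/N for all i, and u is periodic with period 4π/N. -/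
open Filter Topology

/-- A function whose derivative is at least `δ` everywhere expands distances by the factor `δ`. -/
theorem mul_abs_sub_le_abs_image_sub_of_le_deriv {f : ℝ → ℝ} {δ : ℝ}
    (hf : Differentiable ℝ f) (hδ : ∀ x, δ ≤ deriv f x) (x y : ℝ) :
    δ * |x - y| ≤ |f x - f y| := by
  wlog h : y ≤ x generalizing x y
  · rw [abs_sub_comm x, abs_sub_comm (f x)]
    exact this y x (le_of_not_ge h)
  · rw [abs_of_nonneg (sub_nonneg.2 h)]
    exact (mul_sub_le_image_sub_of_le_deriv hf hδ h).trans (le_abs_self _)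

/-- Local uniqueness for a scalar second order equation with Lipschitz right-hand side, in
differential inequality form. -/
theorem eventually_eq_zero_of_abs_deriv_deriv_le {w : ℝ → ℝ} {a K : ℝ}
    (hw : Differentiable ℝ w) (hw' : Differentiable ℝ (deriv w))
    (h0 : w a = 0) (h1 : deriv w a = 0)
    (hK : ∀ᶠ x in 𝓝 a, |deriv (deriv w) x| ≤ K * |w x|) :
    ∀ᶠ x in 𝓝[>] a, w x = 0 := by
  obtain ⟨ε, hε, hball⟩ := Metric.eventually_nhds_iff.1 hK
  have hmem : Set.Ioo a (a + ε) ∈ 𝓝[>] a := Ioo_mem_nhdsGT (by linarith)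
  filter_upwards [hmem] with b hb
  have hW (x : ℝ) : HasDerivAt (fun x => (w x, deriv w x)) (deriv w x, deriv (deriv w) x) x :=
    (hw x).hasDerivAt.prodMk (hw' x).hasDerivAt
  have key := eq_zero_of_abs_deriv_le_mul_abs_self_of_eq_zero_right
    (f := fun x => (w x, deriv w x)) (f' := fun x => (deriv w x, deriv (deriv w) x))
    (K := max 1 K) (a := a) (b := b)
    (fun x _ => (hW x).continuousAt.continuousWithinAt)
    (fun x _ => (hW x).hasDerivWithinAt) (by simp [h0, h1]) ?_ b ⟨hb.1.le, le_rfl⟩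
  · exact (Prod.ext_iff.1 key).1
  · intro x hx
    have hd : dist x a < ε := by
      rw [Real.dist_eq, abs_of_nonneg (by linarith [hx.1])]
      linarith [hx.2, hb.2]
    simp only [Prod.norm_def, Real.norm_eq_abs]
    refine max_le ?_ ?_
    · calc |deriv w x| ≤ 1 * max |w x| |deriv w x| := by rw [one_mul]; exact le_max_right _ _
        _ ≤ _ := by gcongr; exact le_max_left _ _
    · calc |deriv (deriv w) x| ≤ K * |w x| := hball hd
        _ ≤ max 1 K * max |w x| |deriv w x| := by
          gcongr
          · exact le_max_right _ _
          · exact le_max_left _ _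

/-- An analytic solution of a uniformly elliptic equation `F (u, u'') = 0` is symmetric about
each of its critical points. -/
theorem reflection_eq_of_deriv_eq_zero {F : ℝ × ℝ → ℝ} (hF : ∀ p, AnalyticAt ℝ F p)
    {δ : ℝ} (hδ : 0 < δ) (hell : ∀ p, δ ≤ partialQ F p)
    {u : ℝ → ℝ} (hu : ∀ x, AnalyticAt ℝ u x)
    (heq : ∀ x, F (u x, deriv (deriv u) x) = 0)
    {a : ℝ} (ha : deriv u a = 0) (x : ℝ) : u (2 * a - x) = u x := by
  have hu' : ∀ x, AnalyticAt ℝ (deriv u) x := fun x => (hu x).deriv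
  have hu'' : ∀ x, AnalyticAt ℝ (deriv (deriv u)) x := fun x => (hu' x).deriv
  have hv : ∀ x, AnalyticAt ℝ (fun x => u (2 * a - x)) x := fun x =>
    (hu (2 * a - x)).comp_of_eq (analyticAt_const.sub analyticAt_id) rfl
  set w : ℝ → ℝ := fun x => u (2 * a - x) - u x with hw_def
  have hw1 : deriv w = fun x => -deriv u (2 * a - x) - deriv u x := by
    funext y
    rw [hw_def, deriv_fun_sub (hv y).differentiableAt (hu y).differentiableAt,
      deriv_comp_const_sub]
  have hv1 : ∀ x, AnalyticAt ℝ (fun x => deriv u (2 * a - x)) x := fun x =>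
    (hu' (2 * a - x)).comp_of_eq (analyticAt_const.sub analyticAt_id) rfl
  have hw2 : deriv (deriv w) =
      fun x => deriv (deriv u) (2 * a - x) - deriv (deriv u) x := by
    funext y
    rw [hw1, deriv_fun_sub (hv1 y).differentiableAt.fun_neg (hu' y).differentiableAt,
      deriv.fun_neg, deriv_comp_const_sub, neg_neg]
  have hwa : ∀ x, AnalyticAt ℝ w x := fun x => (hv x).sub (hu x)
  obtain ⟨K, s, hs, hLip⟩ :=
    (hF (u a, deriv (deriv u) a)).contDiffAt (n := 1) |>.exists_lipschitzOnWith
  have hrefl : Tendsto (fun x : ℝ => 2 * a - x) (𝓝 a) (𝓝 a) := by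
    have : Continuous fun x : ℝ => 2 * a - x := by fun_prop
    simpa [two_mul] using this.tendsto a
  have hright : ∀ᶠ x in 𝓝 a, (u x, deriv (deriv u) (2 * a - x)) ∈ s :=
    ((hu a).continuousAt.tendsto.prodMk_nhds ((hu'' a).continuousAt.tendsto.comp hrefl)) hs
  have hleft : ∀ᶠ x in 𝓝 a, (u (2 * a - x), deriv (deriv u) (2 * a - x)) ∈ s :=
    (((hu a).continuousAt.tendsto.comp hrefl).prodMk_nhds
      ((hu'' a).continuousAt.tendsto.comp hrefl)) hs
  have hbound : ∀ᶠ x in 𝓝 a, |deriv (deriv w) x| ≤ K / δ * |w x| := by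
    filter_upwards [hright, hleft] with x hx1 hx2
    have hdiff : Differentiable ℝ fun q => F (u x, q) := fun q =>
      (hF (u x, q)).differentiableAt.comp q
        ((differentiableAt_const _).prodMk differentiableAt_id)
    have h1 := mul_abs_sub_le_abs_image_sub_of_le_deriv hdiff (fun q => hell (u x, q))
      (deriv (deriv u) (2 * a - x)) (deriv (deriv u) x)
    have h2 := hLip.dist_le_mul _ hx1 _ hx2
    simp only [Real.dist_eq, Prod.dist_eq, heq, sub_self, abs_zero, sub_zero] at h1 h2
    rw [max_eq_left (abs_nonneg _), abs_sub_comm] at h2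
    rw [hw2, div_mul_eq_mul_div, le_div_iff₀ hδ, mul_comm]
    exact h1.trans h2
  have hz := eventually_eq_zero_of_abs_deriv_deriv_le (fun x => (hwa x).differentiableAt)
    (fun x => (hwa x).deriv.differentiableAt) (by simp [hw_def, two_mul])
    (by simp [hw1, two_mul, ha]) hbound
  have hzero : w = fun _ => 0 :=
    AnalyticOnNhd.eq_of_frequently_eq (z₀ := a) (fun x _ => hwa x) (fun x _ => analyticAt_const)
      (hz.frequently.filter_mono (nhdsGT_le_nhdsNE a))
  exact sub_eq_zero.1 (congrFun hzero x)

/-- Two consecutive gaps of a set that is stable under reflection about its points are equal. -/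
theorem gap_eq_gap_of_reflection_mem {C : Set ℝ} (hC : ∀ a ∈ C, ∀ x ∈ C, 2 * a - x ∈ C)
    {a b c : ℝ} (ha : a ∈ C) (hb : b ∈ C) (hc : c ∈ C) (hab : a < b) (hbc : b < c)
    (hab' : ∀ x ∈ C, x ∉ Set.Ioo a b) (hbc' : ∀ x ∈ C, x ∉ Set.Ioo b c) :
    c - b = b - a := by
  have h1 : 2 * b - c ≤ a := by
    by_contra! h
    exact hab' _ (hC b hb c hc) ⟨h, by linarith⟩
  have h2 : c ≤ 2 * b - a := by
    by_contra! h
    exact hbc' _ (hC b hb a ha) ⟨by linarith, h⟩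
  linarith

/-- **Equal spacing of critical points and periodicity.**
Under the hypotheses of the one-dimensional main theorem, if `u` has exactly
`N` critical points `φ_1 < ... < φ_N` in `[0, 2π)` (extended by
`φ_0 := φ_N − 2π`, `φ_{N+1} := φ_1 + 2π`), then they are equally spaced with
gap `2π/N`, and `u` has period `4π/N`. -/
theorem equally_spaced_and_periodic
    (F : ℝ × ℝ → ℝ) (hFanal : ∀ p : ℝ × ℝ, AnalyticAt ℝ F p)
    (δ : ℝ) (hδ : 0 < δ) (hell : ∀ p : ℝ × ℝ, δ ≤ partialQ F p)
    (u : ℝ → ℝ) (huanal : ∀ x : ℝ, AnalyticAt ℝ u x)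
    (hper : Function.Periodic u (2 * Real.pi))
    (hnonconst : ∃ x y : ℝ, u x ≠ u y)
    (heq : ∀ φ : ℝ, F (u φ, deriv (deriv u) φ) = 0)
    (hextr : ∀ φ : ℝ, deriv u φ = 0 → IsLocalMax u φ ∨ IsLocalMin u φ)
    (hlev : ∃ M m : ℝ, (∀ φ : ℝ, IsLocalMax u φ → u φ = M) ∧
      (∀ φ : ℝ, IsLocalMin u φ → u φ = m))
    (N : ℕ) (hN : 1 ≤ N) (ψ : ℕ → ℝ)
    (hmono : ∀ i j : ℕ, 1 ≤ i → i < j → j ≤ N → ψ i < ψ j)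
    (hcrit : {φ : ℝ | φ ∈ Set.Ico 0 (2 * Real.pi) ∧ deriv u φ = 0} =
      ψ '' (Set.Icc 1 N))
    (hψ0 : ψ 0 = ψ N - 2 * Real.pi)
    (hψN1 : ψ (N + 1) = ψ 1 + 2 * Real.pi) :
    (∀ i : ℕ, 1 ≤ i → i ≤ N → ψ (i + 1) - ψ i = 2 * Real.pi / N) ∧
      Function.Periodic u (4 * Real.pi / N) := by
  have hsymm : ∀ a, deriv u a = 0 → ∀ x, u (2 * a - x) = u x := fun a ha =>
    reflection_eq_of_deriv_eq_zero hFanal hδ hell huanal heq ha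
  have hC : ∀ a ∈ {x | deriv u x = 0}, ∀ x ∈ {x | deriv u x = 0},
      2 * a - x ∈ {x | deriv u x = 0} := by
    intro a ha x hx
    have h : deriv (fun y => u (2 * a - y)) x = deriv u x :=
      congrArg (fun f => deriv f x) (funext (hsymm a ha))
    rw [deriv_comp_const_sub] at h
    simp only [Set.mem_ofPred_eq] at hx ⊢
    linarith
  have hderiv_per : ∀ x, deriv u (x + 2 * Real.pi) = deriv u x := fun x => by
    rw [← deriv_comp_add_const, funext hper]
  have hmem : ∀ i, 1 ≤ i → i ≤ N → ψ i ∈ Set.Ico 0 (2 * Real.pi) ∧ deriv u (ψ i) = 0 :=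
    fun i h1 h2 => hcrit.symm.subset ⟨i, ⟨h1, h2⟩, rfl⟩
  have hle : ∀ i j, 1 ≤ i → i ≤ j → j ≤ N → ψ i ≤ ψ j := fun i j h1 h2 h3 =>
    h2.eq_or_lt.elim (fun h => h ▸ le_rfl) fun h => (hmono i j h1 h h3).le
  have hmem' : ∀ i, 1 ≤ i → i ≤ N + 1 → deriv u (ψ i) = 0 := by
    intro i h1 h2
    rcases h2.eq_or_lt with rfl | h
    · rw [hψN1, hderiv_per]
      exact (hmem 1 le_rfl hN).2
    · exact (hmem i h1 (by omega)).2
  have hlt : ∀ i, 1 ≤ i → i ≤ N → ψ i < ψ (i + 1) := by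
    intro i h1 h2
    rcases h2.eq_or_lt with rfl | h
    · rw [hψN1]
      linarith [(hmem i h1 le_rfl).1.2, (hmem 1 le_rfl hN).1.1]
    · exact hmono i (i + 1) h1 (by omega) h
  have hgap : ∀ i, 1 ≤ i → i ≤ N → ∀ x ∈ {x | deriv u x = 0},
      x ∉ Set.Ioo (ψ i) (ψ (i + 1)) := by
    rintro i h1 h2 x hx ⟨hx1, hx2⟩
    have hx0 : 0 ≤ x := (hmem i h1 h2).1.1.trans hx1.le
    by_cases hxπ : x < 2 * Real.pi
    · obtain ⟨j, ⟨hj1, hj2⟩, rfl⟩ := hcrit.subset ⟨⟨hx0, hxπ⟩, hx⟩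
      rcases le_or_gt j i with hji | hij
      · exact (hle j i hj1 hji h2).not_gt hx1
      · exact (hle (i + 1) j (by omega) hij hj2).not_gt hx2
    · rcases h2.eq_or_lt with rfl | h
      · have hx' : deriv u (x - 2 * Real.pi) = 0 := by
          rw [← hderiv_per, sub_add_cancel]
          exact hx
        have hlt1 := (hmem 1 le_rfl hN).1.2
        obtain ⟨j, ⟨hj1, hj2⟩, hj⟩ := hcrit.subset
          ⟨⟨by linarith, by linarith⟩, hx'⟩
        linarith [hle 1 j le_rfl hj1 hj2]
      · linarith [(hmem (i + 1) (by omega) h).1.2]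
  have hd : ∀ i, 1 ≤ i → i ≤ N → ψ (i + 1) - ψ i = ψ 2 - ψ 1 := by
    intro i h1
    induction i, h1 using Nat.le_induction with
    | base => exact fun _ => rfl
    | succ i h1 ih =>
      intro h2
      rw [← ih (by omega)]
      exact gap_eq_gap_of_reflection_mem hC (hmem' i h1 (by omega))
        (hmem' (i + 1) (by omega) (by omega)) (hmem' (i + 1 + 1) (by omega) (by omega))
        (hlt i h1 (by omega)) (hlt (i + 1) (by omega) h2)
        (hgap i h1 (by omega)) (hgap (i + 1) (by omega) h2)
  have hsum : ∀ n ≤ N, ψ (n + 1) = ψ 1 + n * (ψ 2 - ψ 1) := by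
    intro n
    induction n with
    | zero => simp
    | succ n ih =>
      intro hn
      push_cast
      linarith [ih (by omega), hd (n + 1) (by omega) hn]
  have hN0 : (N : ℝ) ≠ 0 := by positivity
  have hstep : ψ 2 - ψ 1 = 2 * Real.pi / N := by
    rw [eq_div_iff hN0]
    linarith [hsum N le_rfl]
  refine ⟨fun i h1 h2 => (hd i h1 h2).trans hstep, fun x => ?_⟩
  have hx : x + 4 * Real.pi / N = 2 * ψ 2 - (2 * ψ 1 - x) := by
    linear_combination (-2) * hstep
  rw [hx, hsymm _ (hmem' 2 (by omega) (by omega)), hsymm _ (hmem' 1 le_rfl (by omega))]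
end
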